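/- arXiv:1211.2900 — 2 statements merged into one kernel-verified Lean document; each statement's English description precedes it below -/
import Mathlib

section
/- Let μ > 0, δ > 0, ψ(t,x) := a|x|²/(1+t)² with a := μ/(2(2+δ)), and b(t) := μ/(1+t). Then there exists δ₂ > 0, depending only on δ and tending to 0 as δ → 0⁺, such that for all t ≥ 0, all x ∈ ℝⁿ, all v ∈ ℝ and all w ∈ ℝⁿ: |w|² + 4 v (w · ∇ψ(t,x)) + ((−ψ_t(t,x)) b(t) + 2|∇ψ(t,x)|²) v² ≥ δ₂ (|w|² + b(t)(−ψ_t(t,x)) v²). (Here one may take δ₂ := min{δ/(8+δ), δ/(2(2+δ))}-type constants arising from completing the square with weight 4 + δ/2.) -/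
open MeasureTheory Real Filter RealInnerProductSpace ENNReal

noncomputable section

/-- Euclidean space `ℝⁿ`. -/
abbrev En (n : ℕ) := EuclideanSpace ℝ (Fin n)

/-- Spatial Laplacian `Δf` of `f : ℝⁿ → ℝ` at `x`. -/
def lapl {n : ℕ} (f : En n → ℝ) (x : En n) : ℝ :=
  ∑ i, fderiv ℝ (fun y => fderiv ℝ f y (EuclideanSpace.single i 1)) x (EuclideanSpace.single i 1)

/-- Squared norm `|∇f|²` of the spatial gradient of `f` at `x`. -/
def gradSq {n : ℕ} (f : En n → ℝ) (x : En n) : ℝ :=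
  ∑ i, (fderiv ℝ f x (EuclideanSpace.single i 1)) ^ 2

/-- First time derivative `u_t`. -/
def ut {n : ℕ} (u : ℝ → En n → ℝ) (t : ℝ) (x : En n) : ℝ := deriv (fun s => u s x) t

/-- Second time derivative `u_tt`. -/
def utt {n : ℕ} (u : ℝ → En n → ℝ) (t : ℝ) (x : En n) : ℝ := deriv (fun s => ut u s x) t

/-- The weight function `ψ(t,x) = a|x|²/(1+t)²` with `a = μ/(2(2+δ))`. -/
def psiW (μ δ : ℝ) {n : ℕ} (t : ℝ) (x : En n) : ℝ :=
  (μ / (2 * (2 + δ))) * ‖x‖ ^ 2 / (1 + t) ^ 2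

theorem psiW_grad (μ δ : ℝ) {n : ℕ} (t : ℝ) (x : En n) :
    gradient (psiW μ δ t) x = (2 * (μ / (2 * (2 + δ))) / (1 + t) ^ 2) • x := by
  apply HasGradientAt.gradient
  rw [hasGradientAt_iff_hasFDerivAt]
  have h := ((hasStrictFDerivAt_norm_sq x).hasFDerivAt).const_mul
    ((μ / (2 * (2 + δ))) / (1 + t) ^ 2)
  have e : psiW μ δ t = fun y : En n => ((μ / (2 * (2 + δ))) / (1 + t) ^ 2) * ‖y‖ ^ 2 := by
    funext y
    unfold psiW
    ring
  rw [e]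
  refine h.congr_fderiv (ContinuousLinearMap.ext fun y => ?_)
  rw [InnerProductSpace.toDual_apply_apply, real_inner_smul_left]
  simp only [ContinuousLinearMap.smul_apply, innerSL_apply_apply, smul_eq_mul, nsmul_eq_mul]
  push_cast
  ring

theorem psiW_dt (μ δ : ℝ) {n : ℕ} (t : ℝ) (ht : 0 ≤ t) (x : En n) :
    deriv (fun s => psiW μ δ s x) t =
      -(2 * (μ / (2 * (2 + δ))) * ‖x‖ ^ 2 / (1 + t) ^ 3) := by
  have h0 : (1 + t) ≠ 0 := by positivity
  apply HasDerivAt.deriv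
  unfold psiW
  have h1 : HasDerivAt (fun s : ℝ => (1 + s) ^ 2) (2 * (1 + t)) t := by
    have := ((hasDerivAt_id t).const_add 1).pow 2
    exact this.congr_deriv (by simp)
  have h := (hasDerivAt_const t ((μ / (2 * (2 + δ))) * ‖x‖ ^ 2)).div h1 (pow_ne_zero 2 h0)
  refine h.congr_deriv ?_
  generalize μ / (2 * (2 + δ)) = a
  field_simp
  ring

theorem form_aux {n : ℕ} (δ : ℝ) (hδ : 0 < δ) (w g : En n) :
    δ / (6 + 2 * δ) * (‖w‖ ^ 2 + (2 + δ) * ‖g‖ ^ 2) ≤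
      ‖w‖ ^ 2 + 4 * ⟪w, g⟫ + (4 + δ) * ‖g‖ ^ 2 := by
  obtain ⟨d, hd⟩ : ∃ d, d = δ / (6 + 2 * δ) := ⟨_, rfl⟩
  rw [← hd]
  have hd1 : d * (6 + 2 * δ) = δ := by rw [hd]; field_simp
  have hd0 : 0 < d := by rw [hd]; positivity
  have hd2 : 0 < 1 - d := by nlinarith
  have h := sq_nonneg ‖(1 - d) • w + (2 : ℝ) • g‖
  rw [norm_add_sq_real, norm_smul, norm_smul, mul_pow, mul_pow, Real.norm_eq_abs,
    Real.norm_eq_abs, sq_abs, sq_abs, real_inner_smul_left, real_inner_smul_right] at h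
  have hk : 0 ≤ d ^ 2 * (2 + δ) * ‖g‖ ^ 2 := by positivity
  have e : (1 - d) * (‖w‖ ^ 2 + 4 * ⟪w, g⟫ + (4 + δ) * ‖g‖ ^ 2
      - d * (‖w‖ ^ 2 + (2 + δ) * ‖g‖ ^ 2)) =
      ((1 - d) ^ 2 * ‖w‖ ^ 2 + 2 * ((1 - d) * (2 * ⟪w, g⟫)) + 2 ^ 2 * ‖g‖ ^ 2)
      + d ^ 2 * (2 + δ) * ‖g‖ ^ 2 := by
    linear_combination (-‖g‖ ^ 2) * hd1
  have := nonneg_of_mul_nonneg_right (e ▸ add_nonneg h hk) hd2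
  linarith

/-- the quadratic form `T₃` estimate: there is `δ₂ > 0` depending only
on `δ`, tending to `0` as `δ → 0⁺`, such that
`|w|² + 4v(w·∇ψ) + ((-ψ_t)b + 2|∇ψ|²)v² ≥ δ₂(|w|² + b(-ψ_t)v²)`. -/
theorem quadratic_form_T3 (n : ℕ) :
    ∃ δ₂ : ℝ → ℝ, (∀ δ > (0:ℝ), 0 < δ₂ δ) ∧
      Filter.Tendsto δ₂ (nhdsWithin 0 (Set.Ioi 0)) (nhds 0) ∧
      ∀ μ δ : ℝ, 0 < μ → 0 < δ → ∀ t ≥ (0:ℝ), ∀ x : En n, ∀ v : ℝ, ∀ w : En n,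
        δ₂ δ * (‖w‖ ^ 2 + (μ / (1 + t)) * (-(deriv (fun s => psiW μ δ s x) t)) * v ^ 2) ≤
          ‖w‖ ^ 2 + 4 * v * ⟪w, gradient (psiW μ δ t) x⟫ +
            ((-(deriv (fun s => psiW μ δ s x) t)) * (μ / (1 + t)) +
              2 * ‖gradient (psiW μ δ t) x‖ ^ 2) * v ^ 2 := by
  refine ⟨fun δ => δ / (6 + 2 * δ), fun δ hδ => by have : 0 < δ := hδ; positivity, ?_, ?_⟩
  · have : ContinuousAt (fun δ : ℝ => δ / (6 + 2 * δ)) 0 :=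
      ContinuousAt.div (by fun_prop) (by fun_prop) (by norm_num)
    have h := this.tendsto
    simp only [zero_div] at h
    exact h.mono_left nhdsWithin_le_nhds
  · intro μ δ hμ hδ t ht x v w
    have ht' : 0 ≤ t := ht
    have h := form_aux δ hδ w (v • gradient (psiW μ δ t) x)
    have key : (μ / (1 + t)) * (-(deriv (fun s => psiW μ δ s x) t)) =
        (2 + δ) * ‖gradient (psiW μ δ t) x‖ ^ 2 := by
      rw [psiW_dt μ δ t ht', psiW_grad, norm_smul, mul_pow, Real.norm_eq_abs, sq_abs]
      field_simp
      try ring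
    rw [mul_comm (-(deriv (fun s => psiW μ δ s x) t)), key]
    rw [norm_smul, mul_pow, Real.norm_eq_abs, sq_abs, real_inner_smul_right] at h
    show δ / (6 + 2 * δ) * _ ≤ _
    calc _ = _ := by ring
      _ ≤ _ := h
      _ = _ := by ring
end
end

section
/- Let μ > 0, δ > 0, ψ(t,x) := a|x|²/(1+t)² with a := μ/(2(2+δ)), and b(t) := μ/(1+t). Then for all t ≥ 0, x ∈ ℝⁿ with x ≠ 0, all s ∈ ℝ (playing the role of u_t) and all w ∈ ℝⁿ (playing the role of ∇u): (1/(−ψ_t(t,x))) |ψ_t(t,x) w − s ∇ψ(t,x)|² ≥ (1/5)(−ψ_t(t,x)) |w|² − (b(t)/(4(2+δ))) s². -/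
open MeasureTheory Real Filter RealInnerProductSpace ENNReal

noncomputable section

/-- the `T₁` estimate:
`(1/(-ψ_t))|ψ_t w - s∇ψ|² ≥ (1/5)(-ψ_t)|w|² - (b/(4(2+δ)))s²` for `x ≠ 0`. -/
theorem quadratic_form_T1 (n : ℕ) (μ δ : ℝ) (hμ : 0 < μ) (hδ : 0 < δ) :
    ∀ t ≥ (0:ℝ), ∀ x : En n, x ≠ 0 → ∀ s : ℝ, ∀ w : En n,
      (1 / 5) * (-(deriv (fun r => psiW μ δ r x) t)) * ‖w‖ ^ 2
          - ((μ / (1 + t)) / (4 * (2 + δ))) * s ^ 2 ≤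
        (1 / (-(deriv (fun r => psiW μ δ r x) t))) *
          ‖(deriv (fun r => psiW μ δ r x) t) • w - s • gradient (psiW μ δ t) x‖ ^ 2 := by
  intro t ht x hx s w
  have ht1 : (0:ℝ) < 1 + t := by linarith
  have hd : (0:ℝ) < 2 + δ := by linarith
  have hxn : 0 < ‖x‖ := norm_pos_iff.mpr hx
  have hD : deriv (fun r => psiW μ δ r x) t = -((μ / (2 + δ)) * ‖x‖ ^ 2 / (1 + t) ^ 3) := by
    have h1 : HasDerivAt (fun r : ℝ => (1 + r) ^ 2) (2 * (1 + t)) t := by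
      have h0 : HasDerivAt (fun r : ℝ => (1 + r) ^ 2) _ t :=
        ((hasDerivAt_id t).const_add 1).pow 2
      refine h0.congr_deriv ?_
      simp
    have h2 := (hasDerivAt_const t ((μ / (2 * (2 + δ))) * ‖x‖ ^ 2)).div h1 (by positivity)
    have h3 : deriv (fun r => psiW μ δ r x) t = _ := h2.deriv
    rw [h3]
    field_simp
    ring
  have hG : gradient (psiW μ δ t) x = ((μ / (2 + δ)) / (1 + t) ^ 2) • x := by
    apply HasGradientAt.gradient
    rw [hasGradientAt_iff_hasFDerivAt]
    have h1 := ((hasStrictFDerivAt_norm_sq x).hasFDerivAt).const_mul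
      ((μ / (2 * (2 + δ))) / (1 + t) ^ 2)
    have h2 : psiW μ δ t = fun y : En n => (μ / (2 * (2 + δ))) / (1 + t) ^ 2 * ‖y‖ ^ 2 := by
      funext y
      simp only [psiW]
      ring
    rw [h2]
    refine h1.congr_fderiv ?_
    ext y
    simp [inner_smul_left]
    field_simp
  rw [hD, hG]
  set P := (μ / (2 + δ)) * ‖x‖ ^ 2 / (1 + t) ^ 3 with hP
  set c := (μ / (2 + δ)) / (1 + t) ^ 2 with hc
  have hPpos : 0 < P := by positivity
  have hb : (μ / (1 + t)) / (4 * (2 + δ)) = c ^ 2 * ‖x‖ ^ 2 / (4 * P) := by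
    rw [hP, hc]
    field_simp
  have e1 : ‖(-P) • w - s • (c • x)‖ ^ 2
      = P ^ 2 * ‖w‖ ^ 2 + 2 * (P * s * c * inner ℝ w x) + s ^ 2 * c ^ 2 * ‖x‖ ^ 2 := by
    rw [norm_sub_sq_real]
    simp only [norm_smul, inner_smul_left, inner_smul_right, mul_pow, Real.norm_eq_abs, sq_abs,
      conj_trivial]
    ring
  have e2 : ‖P • w + (5 / 4 * s * c) • x‖ ^ 2
      = P ^ 2 * ‖w‖ ^ 2 + 2 * (5 / 4 * P * s * c * inner ℝ w x)
        + 25 / 16 * s ^ 2 * c ^ 2 * ‖x‖ ^ 2 := by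
    rw [norm_add_sq_real]
    simp only [norm_smul, inner_smul_left, inner_smul_right, mul_pow, Real.norm_eq_abs, sq_abs,
      conj_trivial]
    ring
  have e3 : 0 ≤ ‖P • w + (5 / 4 * s * c) • x‖ ^ 2 := by positivity
  rw [e2] at e3
  rw [hb, e1, neg_neg, one_div_mul_eq_div P (P ^ 2 * ‖w‖ ^ 2 + _ + _), le_div_iff₀ hPpos]
  have e4 : (1 / 5 * P * ‖w‖ ^ 2 - c ^ 2 * ‖x‖ ^ 2 / (4 * P) * s ^ 2) * P
      = 1 / 5 * P ^ 2 * ‖w‖ ^ 2 - c ^ 2 * ‖x‖ ^ 2 * s ^ 2 / 4 := by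
    field_simp
  rw [e4]
  linarith
end
end
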